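/- Let K = T^{1+η} with 0 < η < 1/3, let ω be an admissible weight function for T, let φ satisfy the smoothing conditions, and let a, b be complex numbers with |a|, |b| ≤ δ where 0 < δ < η/(2(2+3η)). Then ∫_ℝ ω(t) ∫_{Re s = −1/2+3δ} [ζ(1−a)ζ(1−b)I₁₁(s,t) + ζ(1−a)ζ(1+b)I₁₂(s,t) + ζ(1+a)ζ(1−b)I₂₁(s,t) + ζ(1+a)ζ(1+b)I₂₂(s,t)] ds dt ≪ K^{−1/2+3δ} T^{3/2−δ}. -/

import Mathlib

open Complex MeasureTheory Filter Finset Set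
open scoped Real Topology BigOperators

noncomputable section

namespace CHN

/-- `φ` satisfies the smoothing conditions with parameter `μ`. -/
structure SmoothingFn (μ : ℝ) (φ : ℝ → ℝ) : Prop where
  smooth : ContDiff ℝ (⊤ : ℕ∞) φ
  nonneg : ∀ t : ℝ, 0 ≤ φ t
  eq_one : ∀ t : ℝ, 0 ≤ t → t ≤ 1 → φ t = 1
  eq_zero : ∀ t : ℝ, 1 + μ ≤ t → φ t = 0
  deriv_bound : ∀ j : ℕ, ∃ C : ℝ, 0 < C ∧ ∀ t : ℝ, |iteratedDeriv j φ t| ≤ C * μ⁻¹ ^ j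

/-- `ω` is an admissible weight function for `T` with parameter `ν`, support constants
`c₁ < c₂`, derivative constants `Cd`, and scale `T₀` with `T ^ ν ≤ T₀ ≪ T`. -/
structure AdmissibleWeight (c₁ c₂ ν : ℝ) (Cd : ℕ → ℝ) (T T₀ : ℝ) (ω : ℝ → ℂ) : Prop where
  hc₁ : 0 < c₁
  hc₁₂ : c₁ < c₂
  smooth : ContDiff ℝ (⊤ : ℕ∞) ω
  supp : ∀ t : ℝ, ω t ≠ 0 → c₁ * T ≤ t ∧ t ≤ c₂ * T
  hT₀_low : T ^ ν ≤ T₀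
  hT₀_high : T₀ ≤ T
  deriv_bound : ∀ (j : ℕ) (t : ℝ), ‖iteratedDeriv j ω t‖ ≤ Cd j * T₀⁻¹ ^ j

/-- The Fourier transform `ŵ(u) = ∫ ω(t) e^{-2πiut} dt`. -/
def fhat (ω : ℝ → ℂ) (u : ℝ) : ℂ :=
  ∫ t : ℝ, ω t * Complex.exp (-2 * (Real.pi : ℂ) * Complex.I * (u : ℂ) * (t : ℂ))

/-- `f(s) = s ζ(1+s)`, extended by `f(0) = 1`. -/
def fzeta (s : ℂ) : ℂ := if s = 0 then 1 else s * riemannZeta (1 + s)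

/-- `h(s) = 1/ζ(2+s)`. -/
def hzeta (s : ℂ) : ℂ := (riemannZeta (2 + s))⁻¹

/-- `H(s) = -ζ′(2+s)/ζ(2+s)²`. -/
def Hfun (s : ℂ) : ℂ := -deriv riemannZeta (2 + s) / (riemannZeta (2 + s)) ^ 2

/-- `F(s) = s² ζ′(1+s)`. -/
def Ffun (s : ℂ) : ℂ := s ^ 2 * deriv riemannZeta (1 + s)

/-- `G(s) = -2 ∫₀^∞ φ(t) φ′(t) t^s dt`. -/
def Gfun (φ : ℝ → ℝ) (s : ℂ) : ℂ :=
  -2 * ∫ t in Set.Ioi (0 : ℝ), ((φ t * deriv φ t : ℝ) : ℂ) * (t : ℂ) ^ s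

/-- `Φ₂(s) = ∫₀^∞ φ(t)² t^{s-1} dt`. -/
def Phi2 (φ : ℝ → ℝ) (s : ℂ) : ℂ :=
  ∫ t in Set.Ioi (0 : ℝ), ((φ t ^ 2 : ℝ) : ℂ) * (t : ℂ) ^ (s - 1)

/-- The Mellin transform `Φ(s) = ∫₀^∞ φ(t) t^{s-1} dt`. -/
def MellinPhi (φ : ℝ → ℝ) (s : ℂ) : ℂ :=
  ∫ t in Set.Ioi (0 : ℝ), ((φ t : ℝ) : ℂ) * (t : ℂ) ^ (s - 1)

/-- Taylor coefficients `g_j` of `f(s) = sζ(1+s)` at `s = 0`. -/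
def gcoef (j : ℕ) : ℂ := iteratedDeriv j fzeta 0 / (Nat.factorial j : ℂ)

/-- Taylor coefficients `δ_j` of `1/ζ(2+s)` at `s = 0`. -/
def dcoef (j : ℕ) : ℂ := iteratedDeriv j hzeta 0 / (Nat.factorial j : ℂ)

/-- Taylor coefficients `c_j` of `G(s)` at `s = 0`. -/
def ccoef (φ : ℝ → ℝ) (j : ℕ) : ℂ := iteratedDeriv j (Gfun φ) 0 / (Nat.factorial j : ℂ)

/-- The polynomials `Q_j(x,y)`, for `0 ≤ j ≤ 4` (and `0` for `j ≥ 5`). -/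
def Qpoly (φ : ℝ → ℝ) (j : ℕ) (x y : ℝ) : ℂ :=
  let g : ℕ → ℂ := gcoef
  let δ : ℕ → ℂ := dcoef
  let c : ℕ → ℂ := ccoef φ
  let X : ℂ := (x : ℂ)
  let Y : ℂ := (y : ℂ)
  match j with
  | 0 => 16*δ 4 - 16*δ 1*g 3 + 32*δ 3*g 1 + 32*(g 1)^2*δ 2 - 24*δ 0*g 4 + 8*(g 2)^2*δ 0
       + 5*δ 0*(g 1)^4 + 16*δ 1*(g 1)^3 - 8*δ 0*g 1*g 3 + 16*δ 1*g 1*g 2 + 12*δ 0*(g 1)^2*g 2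
       + 12*(g 1)^2*δ 1*c 1 + 12*δ 0*g 1*g 2*c 1 + 8*δ 3*c 1 + 4*δ 0*(g 1)^3*c 1 + 4*δ 0*g 3*c 1
       + 8*δ 1*g 2*c 1 + 16*g 1*δ 2*c 1 - 4*δ 2*c 2 - 6*(g 1)^2*δ 0*c 2 - 4*δ 0*g 2*c 2
       - 8*g 1*δ 1*c 2 + 4*g 1*δ 0*c 3 + 2*δ 1*c 3 - δ 0*c 4
  | 1 => (4*δ 0*g 3 + 12*δ 0*g 1*g 2 + 4*δ 0*(g 1)^3 + 8*δ 1*g 2 + 12*δ 1*(g 1)^2 + 16*δ 2*g 1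
       + 8*δ 3 - 4*c 1*δ 0*g 2 - 6*c 1*δ 0*(g 1)^2 - 8*c 1*δ 1*g 1 - 4*c 1*δ 2 + 4*c 2*δ 0*g 1
       + 2*c 2*δ 1 - c 3*δ 0) * X
       + (-12*δ 0*g 3 - 4*δ 0*g 1*g 2 - 8*δ 1*g 2 + 4*δ 1*(g 1)^2 + 4*δ 0*(g 1)^3
       + 8*c 1*δ 0*g 2 + 12*c 1*δ 0*(g 1)^2 + 16*c 1*δ 1*g 1 + 8*c 1*δ 2 - 8*c 2*δ 0*g 1
       - 4*c 2*δ 1 + 2*c 3*δ 0) * Y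
  | 2 => (-2*δ 0*g 2 - 3*δ 0*(g 1)^2 - 4*δ 1*g 1 - 2*δ 2 + 2*c 1*δ 0*g 1 + c 1*δ 1
       - c 2*δ 0/2) * X^2
       + (8*δ 0*g 2 + 12*δ 0*(g 1)^2 + 16*δ 1*g 1 + 8*δ 2 - 8*c 1*δ 0*g 1 - 4*c 1*δ 1
       + 2*c 2*δ 0) * X*Y
       + (-5*δ 0*(g 1)^2 - 4*δ 2 - 6*δ 0*g 2 - 8*δ 1*g 1 + 8*c 1*δ 0*g 1 + 4*c 1*δ 1
       - 2*c 2*δ 0) * Y^2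
  | 3 => (2*δ 0*g 1/3 + δ 1/3 - c 1*δ 0/6) * X^3 + (-4*δ 0*g 1 - 2*δ 1 + c 1*δ 0) * X^2*Y
       + (8*δ 0*g 1 + 4*δ 1 - 2*c 1*δ 0) * X*Y^2 + (-4*δ 0*g 1 - 2*δ 1 + 4*c 1*δ 0/3) * Y^3
  | 4 => (1/(24 * riemannZeta 2)) * (-X^4 + 8*X^3*Y - 24*X^2*Y^2 + 32*X*Y^3 - 14*Y^4)
  | _ => 0

/-- The smoothed Dirichlet polynomial `Σ_{n≥1} τ₂(n) n^{-1/2-it} φ(n/K)`. -/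
def tau2Poly (φ : ℝ → ℝ) (K : ℝ) (t : ℝ) : ℂ :=
  ∑' n : ℕ, ((Nat.divisors (n+1)).card : ℂ) *
    ((n+1 : ℕ) : ℂ) ^ (-(1/2 : ℂ) - Complex.I * (t : ℂ)) * ((φ (((n : ℝ)+1)/K) : ℝ) : ℂ)

/-- `D_{2,2;ω}(K) = ∫ ω(t) |Σ_{n≥1} τ₂(n) n^{-1/2-it} φ(n/K)|² dt`. -/
def D22 (φ : ℝ → ℝ) (ω : ℝ → ℂ) (K : ℝ) : ℂ :=
  ∫ t : ℝ, ω t * ((‖tau2Poly φ K t‖ ^ 2 : ℝ) : ℂ)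

/-- The shifted divisor function `σ_A(n)` for a tuple of shifts `A = (a_1, …, a_k)`. -/
def sigmaShift {k : ℕ} (a : Fin k → ℂ) (n : ℕ) : ℂ :=
  ∑ d : Fin k → Fin (n+1), if (∏ i, (d i : ℕ)) = n then ∏ i, ((d i : ℕ) : ℂ) ^ (-a i) else 0

/-- The Ramanujan sum `c_q(r) = Σ_{d ∣ (q, r)} μ(q/d) d`. -/
def ramanujanC (q : ℕ) (r : ℤ) : ℂ :=
  ∑ d ∈ (Nat.gcd q r.natAbs).divisors, ((ArithmeticFunction.moebius (q / d) : ℤ) : ℂ) * (d : ℂ)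

/-- The multiplicative function `g_A(s, n)`. -/
def gA {k : ℕ} (a : Fin k → ℂ) (s : ℂ) (n : ℕ) : ℂ :=
  ∏ p ∈ n.primeFactors,
    (∑' j : ℕ, sigmaShift a (p ^ (j + n.factorization p)) * (p : ℂ) ^ (-(j : ℂ) * s)) /
    (∑' j : ℕ, sigmaShift a (p ^ j) * (p : ℂ) ^ (-(j : ℂ) * s))

/-- The function `G_A(s, n)`. -/
def GA {k : ℕ} (a : Fin k → ℂ) (s : ℂ) (n : ℕ) : ℂ :=
  ∑ d ∈ n.divisors, ((ArithmeticFunction.moebius d : ℤ) : ℂ) * (d : ℂ) ^ s / (Nat.totient d : ℂ) *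
    ∑ e ∈ d.divisors, ((ArithmeticFunction.moebius e : ℤ) : ℂ) / (e : ℂ) ^ s * gA a s (n * e / d)

/-- The shifted convolution sum `D_{F;I,J}(r) = Σ_{m-n=r} σ_I(m) σ_J(n) F(m,n)`. -/
def DFsum {k l : ℕ} (a : Fin k → ℂ) (b : Fin l → ℂ) (F : ℝ → ℝ → ℂ) (r : ℤ) : ℂ :=
  ∑' n : ℕ, if 0 < (n : ℤ) + 1 + r then
      sigmaShift a ((n : ℤ) + 1 + r).toNat * sigmaShift b (n + 1) *
        F ((n : ℝ) + 1 + (r : ℝ)) ((n : ℝ) + 1)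
    else 0

/-- The main term in the additive divisor conjecture. -/
def ADMain {k l : ℕ} (a : Fin k → ℂ) (b : Fin l → ℂ) (F : ℝ → ℝ → ℂ) (r : ℤ) : ℂ :=
  ∑ i₁ : Fin k, ∑ i₂ : Fin l,
    (∏ j₁ ∈ Finset.univ.erase i₁, riemannZeta (1 - a i₁ + a j₁)) *
    (∏ j₂ ∈ Finset.univ.erase i₂, riemannZeta (1 - b i₂ + b j₂)) *
    (∑' q : ℕ, ramanujanC (q + 1) r * GA a (1 - a i₁) (q + 1) * GA b (1 - b i₂) (q + 1) *
        ((q + 1 : ℕ) : ℂ) ^ (a i₁ + b i₂ - 2)) *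
    ∫ x in Set.Ioi (max 0 (r : ℝ)),
      F x (x - (r : ℝ)) * (x : ℂ) ^ (-a i₁) * ((x - (r : ℝ) : ℝ) : ℂ) ^ (-b i₂)

/-- The additive divisor hypothesis `AD_{k,ℓ}(θ, C, β)`. -/
def AD (k l : ℕ) (θ C β : ℝ) : Prop :=
  ∀ ε : ℝ, 0 < ε → ∀ κ : ℝ, 1 ≤ κ → ∀ Dc : ℕ → ℕ → ℝ,
  ∃ C' : ℝ, 0 < C' ∧ ∃ X₀ : ℝ, ∀ P : ℝ, 1 < P → ∀ X Y : ℝ, X₀ ≤ X → 1/2 < Y →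
    X ≤ κ * Y → Y ≤ κ * X →
  ∀ F : ℝ → ℝ → ℂ, ContDiff ℝ (⊤ : ℕ∞) (fun p : ℝ × ℝ => F p.1 p.2) →
    (∀ x y : ℝ, F x y ≠ 0 → (X ≤ x ∧ x ≤ 2 * X) ∧ (Y ≤ y ∧ y ≤ 2 * Y)) →
    (∀ m n : ℕ, ∀ x y : ℝ,
      |x| ^ m * |y| ^ n * ‖iteratedDeriv m (fun x' => iteratedDeriv n (fun y' => F x' y') y) x‖
        ≤ Dc m n * P ^ (m + n)) →
  ∀ a : Fin k → ℂ, ∀ b : Fin l → ℂ, Function.Injective a → Function.Injective b →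
    (∀ i, ‖a i‖ ≤ κ / Real.log X) → (∀ j, ‖b j‖ ≤ κ / Real.log X) →
  ∀ r : ℤ, 1 ≤ r.natAbs → (r.natAbs : ℝ) ≤ κ * X ^ β →
    ‖DFsum a b F r - ADMain a b F r‖ ≤ C' * P ^ C * X ^ (θ + ε)

/-- The mean value `D_{I,J;ω}(K)` of long Dirichlet polynomials with shifted
divisor coefficients. -/
def DmeanShift {k l : ℕ} (a : Fin k → ℂ) (b : Fin l → ℂ) (φ : ℝ → ℝ) (ω : ℝ → ℂ)
    (K : ℝ) : ℂ :=
  ∫ t : ℝ, ω t *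
    (∑' n : ℕ, sigmaShift a (n+1) * ((n+1 : ℕ) : ℂ) ^ (-(1/2 : ℂ) - Complex.I * (t : ℂ)) *
      ((φ (((n : ℝ)+1)/K) : ℝ) : ℂ)) *
    (∑' n : ℕ, sigmaShift b (n+1) * ((n+1 : ℕ) : ℂ) ^ (-(1/2 : ℂ) + Complex.I * (t : ℂ)) *
      ((φ (((n : ℝ)+1)/K) : ℝ) : ℂ))

/-- `Z(I,J) = Π_{i,j} ζ(1 + a_i + b_j)`. -/
def Zfun {k l : ℕ} (a : Fin k → ℂ) (b : Fin l → ℂ) : ℂ :=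
  ∏ i : Fin k, ∏ j : Fin l, riemannZeta (1 + a i + b j)

/-- The Euler product `A(I,J)`. -/
def AEuler {k l : ℕ} (a : Fin k → ℂ) (b : Fin l → ℂ) : ℂ :=
  ∏' p : Nat.Primes,
    ((∏ i : Fin k, ∏ j : Fin l, (1 - ((p : ℕ) : ℂ) ^ (-(1 : ℂ) - a i - b j))) *
      ∑' u : ℕ, sigmaShift a ((p : ℕ) ^ u) * sigmaShift b ((p : ℕ) ^ u) /
        (((p : ℕ) ^ u : ℕ) : ℂ))

/-- `B(I,J) = A(I,J) Z(I,J)`. -/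
def BEuler {k l : ℕ} (a : Fin k → ℂ) (b : Fin l → ℂ) : ℂ := AEuler a b * Zfun a b

/-- The contour integral `∫_{(c)} f(s) ds`, parametrized by `s = c + iu`. -/
def lineInt (c : ℝ) (f : ℂ → ℂ) : ℂ :=
  ∫ u : ℝ, f ((c : ℂ) + (u : ℂ) * Complex.I) * Complex.I

/-- The diagonal main term `M₀(K)`. -/
def M0 {k l : ℕ} (a : Fin k → ℂ) (b : Fin l → ℂ) (φ : ℝ → ℝ) (ω : ℝ → ℂ) (K c : ℝ) : ℂ :=
  fhat ω 0 / (2 * (Real.pi : ℂ) * Complex.I) *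
    lineInt c (fun s => (K : ℂ) ^ s * Phi2 φ s * BEuler (fun i => a i + s) b)

/-- The off-diagonal main term `M₁(K)`. -/
def M1 {k l : ℕ} (a : Fin k → ℂ) (b : Fin l → ℂ) (φ : ℝ → ℝ) (ω : ℝ → ℂ) (K c : ℝ) : ℂ :=
  ∫ t in Set.Ioi (0 : ℝ), ω t *
    ∑ i : Fin k, ∑ j : Fin l,
      ((t / (2 * Real.pi) : ℝ) : ℂ) ^ (-a i - b j) *
      (∏ i' ∈ Finset.univ.erase i, riemannZeta (1 + a i' - a i)) *
      (∏ j' ∈ Finset.univ.erase j, riemannZeta (1 + b j' - b j)) *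
      ((2 * (Real.pi : ℂ) * Complex.I)⁻¹ *
        lineInt c (fun s =>
          Phi2 φ s * ((2 * Real.pi * K / t : ℝ) : ℂ) ^ s *
          (∏ i' ∈ Finset.univ.erase i, ∏ j' ∈ Finset.univ.erase j,
            riemannZeta (1 + (a i' + s) + b j')) *
          riemannZeta (1 - a i - b j - s) *
          AEuler (Function.update a i (-b j - s))
                 (Function.update (fun j' => b j' + s) j (-a i))))

end CHN

namespace CHN

/-- Euler's constant `γ₀` as a complex number. -/
def eulerγ : ℂ := (Real.eulerMascheroniConstant : ℂ)

/-- The term `R₁(a,b)` from Proposition `M₀`. -/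
def R1 (φ : ℝ → ℝ) (K : ℝ) (a b : ℂ) : ℂ :=
  ((Real.log K : ℂ) + ccoef φ 1 + eulerγ) *
      (fzeta (a+b)/(a+b)) * (fzeta a / a) * (fzeta b / b) * hzeta (a+b)
  + 2 * (fzeta (a+b)/(a+b)) * (fzeta a / a) * (fzeta b / b) * Hfun (a+b)
  + (deriv fzeta (a+b)/(a+b) - fzeta (a+b)/(a+b)^2) * (fzeta a / a) * (fzeta b / b) * hzeta (a+b)
  + (fzeta (a+b)/(a+b)) * (deriv fzeta a / a - fzeta a / a^2) * (fzeta b / b) * hzeta (a+b)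
  + (fzeta (a+b)/(a+b)) * (fzeta a / a) * (deriv fzeta b / b - fzeta b / b^2) * hzeta (a+b)

/-- The term `R₁′(a,b)`. -/
def R1' (φ : ℝ → ℝ) (K : ℝ) (a b : ℂ) : ℂ :=
  (a^2)⁻¹ * Gfun φ (-a) * (K : ℂ)^(-a) * (fzeta b / b) * (fzeta (b-a)/(b-a)) *
      fzeta (-a) * hzeta (b-a)
  + (b^2)⁻¹ * Gfun φ (-b) * (K : ℂ)^(-b) * (fzeta a / a) * (fzeta (a-b)/(a-b)) *
      fzeta (-b) * hzeta (a-b)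
  + ((a+b)^2)⁻¹ * Gfun φ (-(a+b)) * (K : ℂ)^(-(a+b)) * (fzeta (-b) / b) * (fzeta (-a) / a) *
      fzeta (-(a+b)) * hzeta (-(a+b))

/-- The term `R₂(a,b;t)`. -/
def R2 (φ : ℝ → ℝ) (K : ℝ) (a b : ℂ) (t : ℝ) : ℂ :=
  let X : ℂ := (Real.log (2 * Real.pi * K / t) : ℂ)
  let g₁ : ℂ := eulerγ
  let c₁ : ℂ := ccoef φ 1
  (-(((2*Real.pi/t : ℝ) : ℂ)^(a+b) * hzeta (-(a+b)) * (fzeta (-a)/a) * (fzeta (-b)/b) *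
      (Ffun (-(a+b))/(a+b)^2 + (fzeta (-(a+b))/(a+b)) * (X + g₁ + c₁)))
  + ((2*Real.pi/t : ℝ) : ℂ)^a * hzeta (b-a) * ((fzeta (-a))^2/a^2) * ((fzeta b)^2/b^2)
  + ((2*Real.pi/t : ℝ) : ℂ)^b * hzeta (a-b) * ((fzeta (-b))^2/b^2) * ((fzeta a)^2/a^2)
  - hzeta (a+b) * (fzeta a / a) * (fzeta b / b) *
      (Ffun (a+b)/(a+b)^2 + (fzeta (a+b)/(a+b)) * (X - g₁ + c₁))
  + (K : ℂ)^(-b) * ((2*Real.pi/t : ℝ) : ℂ)^(a-b) * hzeta (b-a) * (Gfun φ (-b)/b) *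
      (fzeta (b-a)/(b-a)) * (fzeta (-a)/a) * (fzeta b / b)
  + (K : ℂ)^(-a) * ((2*Real.pi/t : ℝ) : ℂ)^(b-a) * hzeta (a-b) * (Gfun φ (-a)/a) *
      (fzeta (a-b)/(a-b)) * (fzeta a / a) * (fzeta (-b)/b)
  - (K : ℂ)^(-(a+b)) * ((2*Real.pi/t : ℝ) : ℂ)^(-(a+b)) * hzeta (a+b) *
      (Gfun φ (-(a+b))/(a+b)) * (fzeta (a+b)/(a+b)) * (fzeta a / a) * (fzeta b / b))

/-- `I₁₁(s,t)`. -/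
def I11 (φ : ℝ → ℝ) (K : ℝ) (a b : ℂ) (s : ℂ) (t : ℝ) : ℂ :=
  (s^2)⁻¹ * Gfun φ s * (K : ℂ)^s * ((2*Real.pi/t : ℝ) : ℂ)^(a+b+s) *
    riemannZeta (1-a-b-s) * fzeta s / riemannZeta (2-a-b)

/-- `I₁₂(s,t)`. -/
def I12 (φ : ℝ → ℝ) (K : ℝ) (a b : ℂ) (s : ℂ) (t : ℝ) : ℂ :=
  s⁻¹ * Gfun φ s * (K : ℂ)^s * ((2*Real.pi/t : ℝ) : ℂ)^(a+s) *
    riemannZeta (1-a-s) * riemannZeta (1+b+s) / riemannZeta (2+b-a)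

/-- `I₂₁(s,t)`. -/
def I21 (φ : ℝ → ℝ) (K : ℝ) (a b : ℂ) (s : ℂ) (t : ℝ) : ℂ :=
  s⁻¹ * Gfun φ s * (K : ℂ)^s * ((2*Real.pi/t : ℝ) : ℂ)^(b+s) *
    riemannZeta (1-b-s) * riemannZeta (1+a+s) / riemannZeta (2+a-b)

/-- `I₂₂(s,t)`. -/
def I22 (φ : ℝ → ℝ) (K : ℝ) (a b : ℂ) (s : ℂ) (t : ℝ) : ℂ :=
  -(s^2)⁻¹ * Gfun φ s * (K : ℂ)^s * ((2*Real.pi/t : ℝ) : ℂ)^s *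
    riemannZeta (1+a+b+s) * fzeta (-s) / riemannZeta (2+a+b)

end CHN

namespace CHN

def zF (n : ℕ) (s : ℂ) : ℂ :=
  (s - 1) * ((n : ℂ) + 1) ^ (-s) + (((n : ℂ) + 2) ^ (1 - s) - ((n : ℂ) + 1) ^ (1 - s))

lemma zF_bound (n : ℕ) (s : ℂ) (hs : 0 < s.re) :
    ‖zF n s‖ ≤ ‖s - 1‖ * ‖s‖ * ((n : ℝ) + 1) ^ (-s.re - 1) := by
  by_cases h1 : s = 1
  · subst h1
    simp [zF]
  have hs0 : -s ≠ 0 := by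
    intro h
    have : s = 0 := by simpa using h
    simp [this] at hs
  have h1s : 1 - s ≠ 0 := fun h => h1 (sub_eq_zero.mp h).symm
  set N : ℝ := (n : ℝ) + 1 with hN
  have hNpos : 0 < N := by positivity
  have step1 : ∀ x ∈ Icc N (N + 1),
      ‖(x : ℂ) ^ (-s) - (N : ℂ) ^ (-s)‖ ≤ ‖s‖ * N ^ (-s.re - 1) * (x - N) := by
    refine norm_image_sub_le_of_norm_deriv_le_segment' (f := fun x : ℝ => (x : ℂ) ^ (-s))
      (f' := fun x : ℝ => (-s) * (x : ℂ) ^ (-s - 1)) ?_ ?_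
    · intro x hx
      have hx0 : x ≠ 0 := by have := hx.1; intro h; linarith
      exact (hasDerivAt_ofReal_cpow_const hx0 hs0).hasDerivWithinAt
    · intro x hx
      have hx0 : 0 < x := lt_of_lt_of_le hNpos hx.1
      rw [norm_mul, norm_neg, Complex.norm_cpow_eq_rpow_re_of_pos hx0]
      gcongr
      simp only [sub_re, neg_re, one_re]
      exact Real.rpow_le_rpow_of_nonpos hNpos hx.1 (by linarith)
  have step2 := norm_image_sub_le_of_norm_deriv_le_segment' (a := N) (b := N + 1)
      (f := fun x : ℝ => (s - 1) * (N : ℂ) ^ (-s) * (x : ℂ) + (x : ℂ) ^ (1 - s))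
      (f' := fun x : ℝ => (s - 1) * (N : ℂ) ^ (-s) * 1 + (1 - s) * (x : ℂ) ^ (1 - s - 1))
      (C := ‖s - 1‖ * ‖s‖ * N ^ (-s.re - 1)) ?_ ?_ (N + 1) ⟨by linarith, le_rfl⟩
  · have e : zF n s = (s - 1) * (N : ℂ) ^ (-s) * ((N + 1 : ℝ) : ℂ) + ((N + 1 : ℝ) : ℂ) ^ (1 - s)
        - ((s - 1) * (N : ℂ) ^ (-s) * (N : ℂ) + (N : ℂ) ^ (1 - s)) := by
      rw [zF, hN]
      push_cast
      rw [show (n : ℂ) + 1 + 1 = n + 2 by ring]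
      ring
    rw [e]
    simpa using step2
  · intro x hx
    have hx0 : x ≠ 0 := by have := hx.1; intro h; linarith
    refine HasDerivAt.hasDerivWithinAt ?_
    refine HasDerivAt.add ?_ (hasDerivAt_ofReal_cpow_const hx0 h1s)
    exact (Complex.ofRealCLM.hasDerivAt (x := x)).const_mul _
  · intro x hx
    have e : (s - 1) * (N : ℂ) ^ (-s) * 1 + (1 - s) * (x : ℂ) ^ (1 - s - 1)
        = -((s - 1) * ((x : ℂ) ^ (-s) - (N : ℂ) ^ (-s))) := by
      rw [show (1 : ℂ) - s - 1 = -s by ring]; ring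
    rw [e, norm_neg, norm_mul, mul_assoc]
    gcongr
    refine (step1 x ⟨hx.1, hx.2.le⟩).trans ?_
    have : x - N ≤ 1 := by linarith [hx.2]
    have h0 : 0 ≤ ‖s‖ * N ^ (-s.re - 1) := by positivity
    nlinarith

lemma zF_diff (n : ℕ) : Differentiable ℂ (zF n) := by
  unfold zF
  have h1 : ((n : ℂ) + 1) ≠ 0 := by exact_mod_cast Nat.succ_ne_zero n
  have h2 : ((n : ℂ) + 2) ≠ 0 := by exact_mod_cast (show n + 2 ≠ 0 by omega)
  intro s
  refine DifferentiableAt.add ?_ (DifferentiableAt.sub ?_ ?_)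
  · exact (by fun_prop : DifferentiableAt ℂ (fun s : ℂ => s - 1) s).mul
      ((by fun_prop : DifferentiableAt ℂ (fun s : ℂ => -s) s).const_cpow (Or.inl h1))
  · exact (by fun_prop : DifferentiableAt ℂ (fun s : ℂ => 1 - s) s).const_cpow (Or.inl h2)
  · exact (by fun_prop : DifferentiableAt ℂ (fun s : ℂ => 1 - s) s).const_cpow (Or.inl h1)

lemma summable_zaux {x : ℝ} (hx : x < -1) : Summable (fun n : ℕ => ((n : ℝ) + 1) ^ x) := by
  have := (summable_nat_add_iff (f := fun n : ℕ => (n : ℝ) ^ x) 1).mpr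
    (Real.summable_nat_rpow.mpr hx)
  simpa using this

lemma zF_tsum (s : ℂ) (hs : 1 < s.re) : ∑' n, zF n s = (s - 1) * riemannZeta s - 1 := by
  have hz := zeta_eq_tsum_one_div_nat_add_one_cpow hs
  have hsum : Summable (fun n : ℕ => 1 / ((n : ℂ) + 1) ^ s) := by
    have := (summable_nat_add_iff (f := fun n : ℕ => 1 / (n : ℂ) ^ s) 1).mpr
      (Complex.summable_one_div_nat_cpow.mpr hs)
    simpa using this
  have hA : HasSum (fun n : ℕ => (s - 1) * ((n : ℂ) + 1) ^ (-s)) ((s - 1) * riemannZeta s) := by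
    rw [hz]
    have := hsum.hasSum.mul_left (s - 1)
    simpa [cpow_neg] using this
  have hS : Summable (fun n => zF n s) := by
    refine Summable.of_norm_bounded (g := fun n : ℕ => ‖s - 1‖ * ‖s‖ * ((n : ℝ) + 1) ^ (-s.re - 1))
      ((summable_zaux (by linarith)).mul_left _) (fun n => zF_bound n s (by linarith))
  have hT : Tendsto (fun N : ℕ => ∑ n ∈ range N, zF n s) atTop (𝓝 ((s - 1) * riemannZeta s - 1)) := by
    have e : (fun N : ℕ => ∑ n ∈ range N, zF n s) = fun N : ℕ =>
        (∑ n ∈ range N, (s - 1) * ((n : ℂ) + 1) ^ (-s)) + (((N : ℂ) + 1) ^ (1 - s) - 1) := by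
      funext N
      simp only [zF, Finset.sum_add_distrib]
      congr 1
      have := Finset.sum_range_sub (fun n : ℕ => ((n : ℂ) + 1) ^ (1 - s)) N
      simp only [Nat.cast_zero, zero_add, one_cpow] at this
      rw [← this]
      refine Finset.sum_congr rfl fun i _ => ?_
      push_cast
      rw [show (i : ℂ) + 1 + 1 = i + 2 by ring]
    rw [e]
    rw [sub_eq_add_neg ((s - 1) * riemannZeta s) 1]
    refine hA.tendsto_sum_nat.add ?_
    have h0 : Tendsto (fun N : ℕ => ((N : ℂ) + 1) ^ (1 - s)) atTop (𝓝 0) := by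
      rw [tendsto_zero_iff_norm_tendsto_zero]
      have e2 : (fun N : ℕ => ‖((N : ℂ) + 1) ^ (1 - s)‖) = fun N : ℕ =>
          ((N : ℝ) + 1) ^ (-(s.re - 1)) := by
        funext N
        have : ((N : ℂ) + 1) = (((N : ℝ) + 1 : ℝ) : ℂ) := by push_cast; rfl
        rw [this, Complex.norm_cpow_eq_rpow_re_of_pos (by positivity)]
        simp
      rw [e2]
      exact (tendsto_rpow_neg_atTop (by linarith)).comp
        (tendsto_atTop_add_const_right _ _ tendsto_natCast_atTop_atTop)
    simpa using h0.sub_const 1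
  exact tendsto_nhds_unique hS.hasSum.tendsto_sum_nat hT

lemma zF_tsum' (s : ℂ) (hs : 1 / 4 < s.re) (h1 : s ≠ 1) :
    ∑' n, zF n s = (s - 1) * riemannZeta s - 1 := by
  set R : ℝ := ‖s‖ + 3 with hR
  set U : Set ℂ := {z : ℂ | 1 / 4 < z.re} ∩ Metric.ball 0 R with hU
  have hUo : IsOpen U := (isOpen_lt continuous_const continuous_re).inter Metric.isOpen_ball
  have hUc : Convex ℝ U := (convex_halfSpace_re_gt _).inter (convex_ball _ _)
  have hd : DifferentiableOn ℂ (fun z => ∑' n, zF n z) U := by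
    refine differentiableOn_tsum_of_summable_norm
      (u := fun n : ℕ => (R + 1) * R * ((n : ℝ) + 1) ^ (-(1/4 : ℝ) - 1))
      ((summable_zaux (by norm_num)).mul_left _) (fun n => (zF_diff n).differentiableOn) hUo ?_
    intro n w hw
    have hw1 : 1 / 4 < w.re := hw.1
    have hw2 : ‖w‖ < R := by simpa using hw.2
    refine (zF_bound n w (by linarith)).trans ?_
    have : ‖w - 1‖ ≤ R + 1 := (norm_sub_le _ _).trans (by simp; linarith)
    have hRp : 0 < R := by positivity
    gcongr
    simp
  have hd2 : DifferentiableOn ℂ (fun z => (z - 1) * riemannZeta₀ z) U := by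
    fun_prop
  have h2U : (2 : ℂ) ∈ U := by
    refine ⟨by simp; norm_num, ?_⟩
    simp only [Metric.mem_ball, dist_zero_right, hR]
    have : ‖(2 : ℂ)‖ = 2 := by simp
    rw [this]; linarith [norm_nonneg s]
  have hsU : s ∈ U := ⟨hs, by simp [hR]⟩
  have key := AnalyticOnNhd.eqOn_of_preconnected_of_eventuallyEq (hd.analyticOnNhd hUo)
    (hd2.analyticOnNhd hUo) hUc.isPreconnected h2U ?_ hsU
  · simp only at key
    rw [key, riemannZeta_eq_inv_sub_add h1, mul_add, mul_inv_cancel₀ (sub_ne_zero.mpr h1)]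
    ring
  · have : {z : ℂ | 1 < z.re} ∈ 𝓝 (2 : ℂ) :=
      (isOpen_lt continuous_const continuous_re).mem_nhds (by simp)
    filter_upwards [this] with z hz
    have hz1 : z ≠ 1 := by rintro rfl; simp at hz
    rw [zF_tsum z hz, riemannZeta_eq_inv_sub_add hz1, mul_add,
      mul_inv_cancel₀ (sub_ne_zero.mpr hz1)]
    ring

lemma zeta_bound : ∃ Z : ℝ, 0 ≤ Z ∧ ∀ s : ℂ, 1 / 2 ≤ s.re → s ≠ 1 →
    ‖riemannZeta s‖ ≤ ‖s - 1‖⁻¹ + Z * ‖s‖ := by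
  have hsm := summable_zaux (x := -(1/2 : ℝ) - 1) (by norm_num)
  refine ⟨∑' n : ℕ, ((n : ℝ) + 1) ^ (-(1/2 : ℝ) - 1), tsum_nonneg fun n => by positivity, ?_⟩
  intro s hs h1
  have h0 : s - 1 ≠ 0 := sub_ne_zero.mpr h1
  have e := zF_tsum' s (by linarith) h1
  have hb : ‖∑' n, zF n s‖ ≤ ‖s - 1‖ * ‖s‖ * ∑' n : ℕ, ((n : ℝ) + 1) ^ (-(1/2 : ℝ) - 1) := by
    rw [← tsum_mul_left]
    refine tsum_of_norm_bounded (hsm.mul_left _).hasSum fun n => ?_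
    refine (zF_bound n s (by linarith)).trans ?_
    gcongr
    simp
  have e2 : riemannZeta s = (s - 1)⁻¹ + (s - 1)⁻¹ * ∑' n, zF n s := by
    rw [e]; field_simp; ring
  rw [e2]
  refine (norm_add_le _ _).trans ?_
  rw [norm_mul, norm_inv]
  have hp : 0 < ‖s - 1‖ := norm_pos_iff.mpr h0
  refine add_le_add le_rfl ?_
  calc ‖s - 1‖⁻¹ * ‖∑' n, zF n s‖
      ≤ ‖s - 1‖⁻¹ * (‖s - 1‖ * ‖s‖ * ∑' n : ℕ, ((n : ℝ) + 1) ^ (-(1/2 : ℝ) - 1)) := by gcongr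
    _ = _ := by
      rw [← mul_assoc, ← mul_assoc, inv_mul_cancel₀ hp.ne', one_mul, mul_comm]

lemma zeta_bound2 : ∃ Z : ℝ, 0 ≤ Z ∧ ∀ s : ℂ, 6 / 5 ≤ s.re → ‖riemannZeta s‖ ≤ Z := by
  have hsm := summable_zaux (x := -(6/5 : ℝ)) (by norm_num)
  refine ⟨∑' n : ℕ, ((n : ℝ) + 1) ^ (-(6/5 : ℝ)), tsum_nonneg fun n => by positivity, ?_⟩
  intro s hs
  rw [zeta_eq_tsum_one_div_nat_add_one_cpow (by linarith)]
  refine tsum_of_norm_bounded hsm.hasSum fun n => ?_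
  have : ((n : ℂ) + 1) = (((n : ℝ) + 1 : ℝ) : ℂ) := by push_cast; rfl
  rw [one_div, norm_inv, this, Complex.norm_cpow_eq_rpow_re_of_pos (by positivity),
    ← Real.rpow_neg (by positivity)]
  gcongr
  simp

lemma ibp_step (g : ℝ → ℝ) (hg : ContDiff ℝ 1 g) (h1 : g (1/2) = 0) (h2 : g 2 = 0)
    (s : ℂ) (hs : 0 < s.re) :
    s * ∫ t in (1/2 : ℝ)..2, ((g t : ℝ) : ℂ) * (t : ℂ) ^ (s - 1) =
      - ∫ t in (1/2 : ℝ)..2, ((deriv g t : ℝ) : ℂ) * (t : ℂ) ^ s := by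
  have hs0 : s ≠ 0 := by rintro rfl; simp at hs
  have hpos : ∀ x ∈ Set.uIcc (1/2 : ℝ) 2, 0 < x := by
    intro x hx
    rw [Set.uIcc_of_le (by norm_num)] at hx
    linarith [hx.1]
  have hc : ∀ r : ℂ, ContinuousOn (fun t : ℝ => (t : ℂ) ^ r) (Set.uIcc (1/2 : ℝ) 2) := by
    intro r x hx
    exact (Complex.continuousAt_ofReal_cpow_const x r (Or.inr (hpos x hx).ne')).continuousWithinAt
  have := intervalIntegral.integral_mul_deriv_eq_deriv_mul (a := (1/2 : ℝ)) (b := 2)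
    (u := fun t : ℝ => ((g t : ℝ) : ℂ)) (v := fun t : ℝ => (t : ℂ) ^ s)
    (u' := fun t : ℝ => ((deriv g t : ℝ) : ℂ)) (v' := fun t : ℝ => s * (t : ℂ) ^ (s - 1))
    (fun x hx => ((hg.differentiable (by norm_num)).differentiableAt.hasDerivAt).ofReal_comp)
    (fun x hx => hasDerivAt_ofReal_cpow_const (hpos x hx).ne' hs0)
    ((continuous_ofReal.comp (hg.continuous_deriv le_rfl)).intervalIntegrable _ _)
    ((continuousOn_const.mul (hc _)).intervalIntegrable)
  simp only [h1, h2, ofReal_zero, zero_mul, sub_zero, zero_sub] at this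
  rw [← this, ← intervalIntegral.integral_const_mul]
  congr 1
  ext t
  ring

lemma G_bound (μ : ℝ) (hμ0 : 0 < μ) (hμ1 : μ < 1/2) (φ : ℝ → ℝ) (hφ : SmoothingFn μ φ)
    (c : ℝ) (hc : -(1/2) ≤ c) :
    ∃ C : ℝ, 0 ≤ C ∧ ∀ s : ℂ, s.re = c → ‖Gfun φ s‖ ≤ C / (‖s + 1‖ * ‖s + 2‖) := by
  set g : ℝ → ℝ := fun t => φ t * deriv φ t with hg
  have hφs : ContDiff ℝ (⊤ : ℕ∞) φ := hφ.smooth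
  have hφd : ContDiff ℝ (⊤ : ℕ∞) (deriv φ) := ((contDiff_infty_iff_deriv).mp hφs).2
  have hgs : ContDiff ℝ (⊤ : ℕ∞) g := hφs.mul hφd
  have hgd : ContDiff ℝ (⊤ : ℕ∞) (deriv g) := ((contDiff_infty_iff_deriv).mp hgs).2
  have hgdd : ContDiff ℝ (⊤ : ℕ∞) (deriv (deriv g)) := ((contDiff_infty_iff_deriv).mp hgd).2
  have z1 : ∀ t ∈ Ioo (0 : ℝ) 1, g t = 0 := by
    intro t ht
    have : φ =ᶠ[𝓝 t] fun _ => 1 := by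
      filter_upwards [Ioo_mem_nhds ht.1 ht.2] with x hx using hφ.eq_one x hx.1.le hx.2.le
    simp [hg, this.deriv_eq]
  have z2 : ∀ t, 3 / 2 ≤ t → g t = 0 := by
    intro t ht
    simp [hg, hφ.eq_zero t (by linarith)]
  have e1 : g =ᶠ[𝓝 (1/2)] fun _ => 0 := by
    filter_upwards [Ioo_mem_nhds (show (0:ℝ) < 1/2 by norm_num) (show (1/2:ℝ) < 1 by norm_num)]
      with x hx using z1 x hx
  have e2 : g =ᶠ[𝓝 2] fun _ => 0 := by
    filter_upwards [Ioi_mem_nhds (show (3/2:ℝ) < 2 by norm_num)] with x hx using z2 x (le_of_lt hx)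
  have hG : ∀ s : ℂ, Gfun φ s = -2 * ∫ t in (1/2 : ℝ)..2, ((g t : ℝ) : ℂ) * (t : ℂ) ^ s := by
    intro s
    rw [Gfun, intervalIntegral.integral_of_le (by norm_num)]
    congr 1
    refine setIntegral_eq_of_subset_of_forall_sdiff_eq_zero measurableSet_Ioi ?_ ?_
    · intro x hx
      have : (1/2 : ℝ) < x := hx.1
      exact lt_trans (by norm_num) this
    · intro x hx
      have hx0 : 0 < x := hx.1
      have hgx : g x = 0 := by
        by_cases h : x < 1
        · exact z1 x ⟨hx0, h⟩
        · refine z2 x ?_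
          by_contra h'
          exact hx.2 ⟨by linarith, by linarith⟩
      have : φ x * deriv φ x = 0 := hgx
      rw [this]; simp
  obtain ⟨M, hM⟩ : ∃ M, ∀ t ∈ Icc (1/2 : ℝ) 2, ‖deriv (deriv g) t‖ ≤ M :=
    isCompact_Icc.exists_bound_of_continuousOn hgdd.continuous.continuousOn
  have hM0 : 0 ≤ M := (norm_nonneg _).trans (hM 1 ⟨by norm_num, by norm_num⟩)
  refine ⟨2 * (M * 2 ^ (c + 2) * |2 - 1/2|), by positivity, ?_⟩
  intro s hs
  have a1 := ibp_step g (hgs.of_le (by exact_mod_cast le_top)) e1.eq_of_nhds e2.eq_of_nhds (s + 1)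
    (by simp [hs]; linarith)
  have a2 := ibp_step (deriv g) (hgd.of_le (by exact_mod_cast le_top))
    (by rw [e1.deriv_eq]; simp) (by rw [e2.deriv_eq]; simp) (s + 2)
    (by simp [hs]; linarith)
  rw [show s + 1 - 1 = s by ring] at a1
  rw [show s + 2 - 1 = s + 1 by ring] at a2
  have hs1 : s + 1 ≠ 0 := by
    intro h; have := congrArg re h; simp [hs] at this; linarith
  have hs2 : s + 2 ≠ 0 := by
    intro h; have := congrArg re h; simp [hs] at this; linarith
  have p1 : 0 < ‖s + 1‖ := norm_pos_iff.mpr hs1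
  have p2 : 0 < ‖s + 2‖ := norm_pos_iff.mpr hs2
  rw [le_div_iff₀ (by positivity), ← norm_mul, ← norm_mul, hG]
  have e : (-2 * ∫ t in (1/2 : ℝ)..2, ((g t : ℝ) : ℂ) * (t : ℂ) ^ s) * ((s + 1) * (s + 2))
      = -2 * ∫ t in (1/2 : ℝ)..2, ((deriv (deriv g) t : ℝ) : ℂ) * (t : ℂ) ^ (s + 2) := by
    linear_combination (-2 * (s + 2)) * a1 + 2 * a2
  rw [e, norm_mul]
  have : ‖(-2 : ℂ)‖ = 2 := by simp
  rw [this]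
  gcongr
  refine intervalIntegral.norm_integral_le_of_norm_le_const fun t ht => ?_
  rw [uIoc_of_le (by norm_num)] at ht
  have ht0 : 0 < t := lt_trans (by norm_num) ht.1
  rw [norm_mul, Complex.norm_cpow_eq_rpow_re_of_pos ht0, Complex.norm_real]
  have hre : (s + 2).re = c + 2 := by simp [hs]
  rw [hre]
  have := hM t ⟨ht.1.le, ht.2⟩
  gcongr
  · linarith
  · exact ht.2

lemma combo (δ : ℝ) (hδ : 0 < δ) : ∃ C : ℝ, 0 ≤ C ∧ ∀ (P Q : ℂ → ℂ) (M : ℝ),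
    DifferentiableOn ℂ P (Metric.ball 0 δ) → DifferentiableOn ℂ Q (Metric.ball 0 δ) → P 0 = Q 0 →
    (∀ a, ‖a‖ ≤ δ → ‖P a‖ ≤ M) → (∀ a, ‖a‖ ≤ δ → ‖Q a‖ ≤ M) →
    ∀ a, ‖a‖ ≤ δ → ‖riemannZeta (1 - a) * P a + riemannZeta (1 + a) * Q a‖ ≤ C * M := by
  obtain ⟨B, hB⟩ : ∃ B, ∀ z ∈ Metric.closedBall (1 : ℂ) δ, ‖riemannZeta₀ z‖ ≤ B :=
    (isCompact_closedBall _ _).exists_bound_of_continuousOn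
      differentiable_riemannZeta₀.continuous.continuousOn
  have hB0 : 0 ≤ B := (norm_nonneg _).trans (hB 1 (by simp [hδ.le]))
  refine ⟨2 / δ + 2 * B + 2 * ‖riemannZeta 1‖, by positivity, ?_⟩
  intro P Q M hP hQ h0 hPM hQM a ha
  have hM0 : 0 ≤ M := (norm_nonneg _).trans (hPM a ha)
  by_cases ha0 : a = 0
  · subst ha0
    have h1 := hPM 0 ha
    have h2 := hQM 0 ha
    simp only [sub_zero, add_zero]
    calc _ ≤ ‖riemannZeta 1‖ * ‖P 0‖ + ‖riemannZeta 1‖ * ‖Q 0‖ := by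
          refine (norm_add_le _ _).trans ?_
          rw [norm_mul, norm_mul]
      _ ≤ ‖riemannZeta 1‖ * M + ‖riemannZeta 1‖ * M := by gcongr
      _ ≤ _ := by
          have : 0 ≤ (2 / δ + 2 * B) * M := by positivity
          nlinarith
  have hap : 0 < ‖a‖ := norm_pos_iff.mpr ha0
  have key : ‖Q a - P a‖ ≤ 2 * M / δ * ‖a‖ := by
    rcases lt_or_eq_of_le ha with hlt | heq
    · have := Complex.dist_le_div_mul_dist_of_mapsTo_ball (f := fun z => Q z - P z) (c := 0)
        (R₁ := δ) (R₂ := 2 * M) (z := a) (hQ.sub hP) ?_ (by simpa using hlt)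
      · simpa [h0, dist_eq_norm] using this
      · intro z hz
        have hz' : ‖z‖ < δ := by simpa using hz
        simp only [h0, sub_self, mem_closedBall_zero_iff]
        refine (norm_sub_le _ _).trans ?_
        linarith [hPM z hz'.le, hQM z hz'.le]
    · rw [heq, div_mul_cancel₀ _ hδ.ne']
      refine (norm_sub_le _ _).trans ?_
      linarith [hPM a ha, hQM a ha]
  have e1 : riemannZeta (1 - a) = -a⁻¹ + riemannZeta₀ (1 - a) := by
    rw [riemannZeta_eq_inv_sub_add (by simpa using ha0)]
    congr 1
    rw [show (1 : ℂ) - a - 1 = -a by ring, inv_neg]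
  have e2 : riemannZeta (1 + a) = a⁻¹ + riemannZeta₀ (1 + a) := by
    rw [riemannZeta_eq_inv_sub_add (by simpa using ha0)]
    congr 1
    rw [show (1 : ℂ) + a - 1 = a by ring]
  have e : riemannZeta (1 - a) * P a + riemannZeta (1 + a) * Q a =
      a⁻¹ * (Q a - P a) + (riemannZeta₀ (1 - a) * P a + riemannZeta₀ (1 + a) * Q a) := by
    rw [e1, e2]; ring
  rw [e]
  have b1 : ‖riemannZeta₀ (1 - a)‖ ≤ B := hB _ (by simpa [dist_eq_norm] using ha)
  have b2 : ‖riemannZeta₀ (1 + a)‖ ≤ B := hB _ (by simpa [dist_eq_norm] using ha)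
  calc _ ≤ ‖a‖⁻¹ * ‖Q a - P a‖ + (‖riemannZeta₀ (1 - a)‖ * ‖P a‖
          + ‖riemannZeta₀ (1 + a)‖ * ‖Q a‖) := by
        refine (norm_add_le _ _).trans ?_
        rw [norm_mul, norm_inv]
        gcongr
        refine (norm_add_le _ _).trans ?_
        rw [norm_mul, norm_mul]
    _ ≤ ‖a‖⁻¹ * (2 * M / δ * ‖a‖) + (B * M + B * M) := by
        have h1 := hPM a ha
        have h2 := hQM a ha
        gcongr
    _ = (2 / δ + 2 * B) * M := by field_simp; ring
    _ ≤ _ := by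
        have : 0 ≤ 2 * ‖riemannZeta 1‖ * M := by positivity
        nlinarith

lemma combo2 (δ : ℝ) (hδ : 0 < δ) : ∃ C : ℝ, 0 ≤ C ∧ ∀ (J : ℂ → ℂ → ℂ) (M : ℝ),
    (∀ z w : ℂ, ‖z‖ ≤ 2 * δ → ‖w‖ ≤ 2 * δ → ‖w - z‖ ≤ 2 * δ → ‖J z w‖ ≤ M) →
    (∀ z w : ℂ, ‖z‖ ≤ 2 * δ → ‖w‖ ≤ 2 * δ → ‖w - z‖ ≤ 2 * δ →
      DifferentiableAt ℂ (fun p : ℂ × ℂ => J p.1 p.2) (z, w)) →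
    ∀ a b : ℂ, ‖a‖ ≤ δ → ‖b‖ ≤ δ →
    ‖riemannZeta (1-a) * riemannZeta (1-b) * J (a + b) 0
      + riemannZeta (1-a) * riemannZeta (1+b) * J a b
      + riemannZeta (1+a) * riemannZeta (1-b) * J b a
      + riemannZeta (1+a) * riemannZeta (1+b) * J 0 (a + b)‖ ≤ C * M := by
  obtain ⟨C, hC0, hC⟩ := combo δ hδ
  refine ⟨C * C, by positivity, ?_⟩
  intro J M hM hJ a b ha hb
  have nadd : ∀ x y : ℂ, ‖x‖ ≤ δ → ‖y‖ ≤ δ → ‖x + y‖ ≤ 2 * δ := fun x y hx hy =>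
    (norm_add_le x y).trans (by linarith)
  have nsub : ∀ x y : ℂ, ‖x‖ ≤ δ → ‖y‖ ≤ δ → ‖x - y‖ ≤ 2 * δ := fun x y hx hy =>
    (norm_sub_le x y).trans (by linarith)
  have n0 : ‖(0 : ℂ)‖ ≤ 2 * δ := by simp [hδ.le]
  have m1 : ∀ x y : ℂ, ‖x‖ ≤ δ → ‖y‖ ≤ δ → ‖J (x + y) 0‖ ≤ M := fun x y hx hy =>
    hM _ _ (nadd x y hx hy) n0 (by rw [zero_sub, norm_neg]; exact nadd x y hx hy)
  have m2 : ∀ x y : ℂ, ‖x‖ ≤ δ → ‖y‖ ≤ δ → ‖J x y‖ ≤ M := fun x y hx hy =>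
    hM _ _ (by linarith) (by linarith) (nsub y x hy hx)
  have m3 : ∀ x y : ℂ, ‖x‖ ≤ δ → ‖y‖ ≤ δ → ‖J 0 (x + y)‖ ≤ M := fun x y hx hy =>
    hM _ _ n0 (nadd x y hx hy) (by simpa using nadd x y hx hy)
  have d1 : ∀ x y : ℂ, ‖x‖ ≤ δ → ‖y‖ ≤ δ →
      DifferentiableAt ℂ (fun p : ℂ × ℂ => J p.1 p.2) (x + y, 0) := fun x y hx hy =>
    hJ _ _ (nadd x y hx hy) n0 (by rw [zero_sub, norm_neg]; exact nadd x y hx hy)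
  have d2 : ∀ x y : ℂ, ‖x‖ ≤ δ → ‖y‖ ≤ δ →
      DifferentiableAt ℂ (fun p : ℂ × ℂ => J p.1 p.2) (x, y) := fun x y hx hy =>
    hJ _ _ (by linarith) (by linarith) (nsub y x hy hx)
  have d3 : ∀ x y : ℂ, ‖x‖ ≤ δ → ‖y‖ ≤ δ →
      DifferentiableAt ℂ (fun p : ℂ × ℂ => J p.1 p.2) (0, x + y) := fun x y hx hy =>
    hJ _ _ n0 (nadd x y hx hy) (by simpa using nadd x y hx hy)
  have cmp : ∀ (f g : ℂ → ℂ) (x : ℂ), DifferentiableAt ℂ (fun p : ℂ × ℂ => J p.1 p.2) (f x, g x) →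
      Differentiable ℂ f → Differentiable ℂ g → DifferentiableAt ℂ (fun x => J (f x) (g x)) x := by
    intro f g x h hf hg
    exact DifferentiableAt.comp (g := fun p : ℂ × ℂ => J p.1 p.2) (f := fun x => (f x, g x)) x h
      ((hf x).prodMk (hg x))
  have hP : ∀ x, ‖x‖ ≤ δ →
      ‖riemannZeta (1 - b) * J (x + b) 0 + riemannZeta (1 + b) * J x b‖ ≤ C * M := by
    intro x hx
    refine hC (fun y => J (x + y) 0) (fun y => J x y) M ?_ ?_ (by simp) (fun y hy => m1 x y hx hy)
      (fun y hy => m2 x y hx hy) b hb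
    · intro y hy
      have hy' : ‖y‖ ≤ δ := le_of_lt (by simpa using hy)
      exact (cmp (fun y => x + y) (fun _ => 0) y (d1 x y hx hy') (by fun_prop)
        (by fun_prop)).differentiableWithinAt
    · intro y hy
      have hy' : ‖y‖ ≤ δ := le_of_lt (by simpa using hy)
      exact (cmp (fun _ => x) (fun y => y) y (d2 x y hx hy') (by fun_prop)
        (by fun_prop)).differentiableWithinAt
  have hQ : ∀ x, ‖x‖ ≤ δ →
      ‖riemannZeta (1 - b) * J b x + riemannZeta (1 + b) * J 0 (x + b)‖ ≤ C * M := by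
    intro x hx
    refine hC (fun y => J y x) (fun y => J 0 (x + y)) M ?_ ?_ (by simp) (fun y hy => m2 y x hy hx)
      (fun y hy => m3 x y hx hy) b hb
    · intro y hy
      have hy' : ‖y‖ ≤ δ := le_of_lt (by simpa using hy)
      exact (cmp (fun y => y) (fun _ => x) y (d2 y x hy' hx) (by fun_prop)
        (by fun_prop)).differentiableWithinAt
    · intro y hy
      have hy' : ‖y‖ ≤ δ := le_of_lt (by simpa using hy)
      exact (cmp (fun _ => 0) (fun y => x + y) y (d3 x y hx hy') (by fun_prop)
        (by fun_prop)).differentiableWithinAt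
  have fin := hC (fun x => riemannZeta (1 - b) * J (x + b) 0 + riemannZeta (1 + b) * J x b)
    (fun x => riemannZeta (1 - b) * J b x + riemannZeta (1 + b) * J 0 (x + b)) (C * M)
    ?_ ?_ (by simp) hP hQ a ha
  · refine le_trans (le_of_eq ?_) (fin.trans (le_of_eq (by ring)))
    congr 1
    ring
  · intro y hy
    have hy' : ‖y‖ ≤ δ := le_of_lt (by simpa using hy)
    refine DifferentiableAt.differentiableWithinAt ?_
    exact ((cmp (fun y => y + b) (fun _ => 0) y (d1 y b hy' hb) (by fun_prop)
      (by fun_prop)).const_mul _).add ((cmp (fun y => y) (fun _ => b) y (d2 y b hy' hb)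
      (by fun_prop) (by fun_prop)).const_mul _)
  · intro y hy
    have hy' : ‖y‖ ≤ δ := le_of_lt (by simpa using hy)
    refine DifferentiableAt.differentiableWithinAt ?_
    exact ((cmp (fun _ => b) (fun y => y) y (d2 b y hb hy') (by fun_prop)
      (by fun_prop)).const_mul _).add ((cmp (fun _ => 0) (fun y => y + b) y (d3 y b hy' hb)
      (by fun_prop) (by fun_prop)).const_mul _)

def Jfun (φ : ℝ → ℝ) (K : ℝ) (s : ℂ) (t : ℝ) (z w : ℂ) : ℂ :=
  s⁻¹ * Gfun φ s * (K : ℂ)^s * ((2*Real.pi/t : ℝ) : ℂ)^(z+s) *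
    riemannZeta (1-z-s) * riemannZeta (1+w+s) * (riemannZeta (2+(w-z)))⁻¹

lemma I11_eq (φ : ℝ → ℝ) (K : ℝ) (a b s : ℂ) (t : ℝ) (hs : s ≠ 0) :
    I11 φ K a b s t = Jfun φ K s t (a + b) 0 := by
  simp only [I11, Jfun, fzeta, if_neg hs]
  rw [show (1 : ℂ) - a - b - s = 1 - (a + b) - s by ring,
    show (2 : ℂ) - a - b = 2 + (0 - (a + b)) by ring, add_zero, div_eq_mul_inv]
  field_simp

lemma I12_eq (φ : ℝ → ℝ) (K : ℝ) (a b s : ℂ) (t : ℝ) :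
    I12 φ K a b s t = Jfun φ K s t a b := by
  simp only [I12, Jfun]
  rw [show (2 : ℂ) + b - a = 2 + (b - a) by ring, div_eq_mul_inv]

lemma I21_eq (φ : ℝ → ℝ) (K : ℝ) (a b s : ℂ) (t : ℝ) :
    I21 φ K a b s t = Jfun φ K s t b a := by
  simp only [I21, Jfun]
  rw [show (2 : ℂ) + a - b = 2 + (a - b) by ring, div_eq_mul_inv]

lemma I22_eq (φ : ℝ → ℝ) (K : ℝ) (a b s : ℂ) (t : ℝ) (hs : s ≠ 0) :
    I22 φ K a b s t = Jfun φ K s t 0 (a + b) := by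
  have hs' : -s ≠ 0 := neg_ne_zero.mpr hs
  simp only [I22, Jfun, fzeta, if_neg hs']
  rw [show (1 : ℂ) + a + b + s = 1 + (a + b) + s by ring, show (1 : ℂ) + -s = 1 - 0 - s by ring,
    show (2 : ℂ) + a + b = 2 + (a + b - 0) by ring, zero_add, div_eq_mul_inv]
  field_simp

lemma re_bd {z : ℂ} {r : ℝ} (h : ‖z‖ ≤ r) : -r ≤ z.re ∧ z.re ≤ r :=
  abs_le.mp ((Complex.abs_re_le_norm z).trans h)

lemma Jfun_bound (μ : ℝ) (hμ0 : 0 < μ) (hμ1 : μ < 1/2) (φ : ℝ → ℝ) (hφ : SmoothingFn μ φ)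
    (δ : ℝ) (hδ0 : 0 < δ) (hδ : δ < 1 / 18) (c₂ : ℝ) :
    ∃ C : ℝ, 0 ≤ C ∧ ∀ (K T t : ℝ) (s z w : ℂ), 0 < K → 1 ≤ T → 0 < t → t ≤ c₂ * T →
      s.re = -(1/2) + 3 * δ → ‖z‖ ≤ 2 * δ → ‖w‖ ≤ 2 * δ → ‖w - z‖ ≤ 2 * δ →
      ‖Jfun φ K s t z w‖ ≤ C * (K ^ (-(1/2) + 3 * δ) * T ^ (1/2 - δ)) *
        (1 / (‖s + 1‖ * ‖s + 2‖)) := by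
  obtain ⟨Cg, hCg0, hCg⟩ := G_bound μ hμ0 hμ1 φ hφ (-(1/2) + 3 * δ) (by linarith)
  obtain ⟨Z, hZ0, hZ⟩ := zeta_bound
  obtain ⟨B, hB0, hB⟩ := zeta_bound2
  obtain ⟨D, hD⟩ : ∃ D, ∀ z ∈ Metric.closedBall (2 : ℂ) (2 * δ), ‖(riemannZeta z)⁻¹‖ ≤ D := by
    refine (isCompact_closedBall _ _).exists_bound_of_continuousOn ?_
    intro z hz
    have h1 : ‖z - 2‖ ≤ 2 * δ := by simpa [dist_eq_norm] using hz
    have h2 := (re_bd h1).1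
    simp only [sub_re, re_ofNat] at h2
    have h3 : 1 < z.re := by linarith
    refine ContinuousAt.continuousWithinAt ?_
    exact (differentiableAt_riemannZeta (by rintro rfl; simp at h3)).continuousAt.inv₀
      (riemannZeta_ne_zero_of_one_lt_re h3)
  have hD0 : 0 ≤ D := (norm_nonneg _).trans (hD 2 (by simp; linarith))
  set c' : ℝ := max 1 c₂ with hc'
  have hc1 : 1 ≤ c' := le_max_left _ _
  refine ⟨Cg * c' * B * (15 + 7 * Z) * D, by positivity, ?_⟩
  intro K T t s z w hK hT ht htc hs hz hw hwz
  have hzr := re_bd hz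
  have hwr := re_bd hw
  have hs13 : 1 / 3 ≤ ‖s‖ := by
    have := Complex.abs_re_le_norm s
    rw [hs, abs_of_neg (by linarith)] at this
    linarith
  have hspos : 0 < ‖s‖ := by linarith
  have b1 : ‖riemannZeta (1 - z - s)‖ ≤ B := hB _ (by
    simp only [sub_re, one_re, hs]; linarith)
  have hws : 1 / 5 ≤ ‖w + s‖ := by
    have := Complex.abs_re_le_norm (w + s)
    simp only [add_re, hs] at this
    rw [abs_of_neg (by linarith)] at this
    linarith
  have b2 : ‖riemannZeta (1 + w + s)‖ ≤ (15 + 7 * Z) * ‖s‖ := by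
    have h1 : (1 + w + s) - 1 = w + s := by ring
    have := hZ (1 + w + s) (by simp only [add_re, one_re, hs]; linarith) (by
      intro h
      rw [h, sub_self] at h1
      rw [← h1] at hws
      norm_num at hws)
    rw [h1] at this
    have h2 : ‖w + s‖⁻¹ ≤ 5 := by
      have := inv_anti₀ (by norm_num) hws
      norm_num at this
      exact this
    have h3 : ‖1 + w + s‖ ≤ 7 * ‖s‖ := by
      refine (norm_add_le _ _).trans ?_
      have : ‖1 + w‖ ≤ 1 + ‖w‖ := (norm_add_le _ _).trans (by simp)
      linarith
    nlinarith [mul_le_mul_of_nonneg_left h3 hZ0]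
  have b3 : ‖(riemannZeta (2 + (w - z)))⁻¹‖ ≤ D := hD _ (by simpa [dist_eq_norm] using hwz)
  have b4 : ‖((2*Real.pi/t : ℝ) : ℂ)^(z+s)‖ ≤ c' * T ^ (1/2 - δ) := by
    have hpos : 0 < 2 * Real.pi / t := by positivity
    rw [Complex.norm_cpow_eq_rpow_re_of_pos hpos]
    have h1 : (2 * Real.pi / t) ^ (z + s).re = (t / (2 * Real.pi)) ^ (-(z + s).re) := by
      rw [Real.rpow_neg (by positivity), ← Real.inv_rpow (by positivity), inv_div]
    rw [h1]
    have hy : -(z + s).re ≤ 1 / 2 - δ := by simp only [add_re, hs]; linarith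
    have hy0 : 0 ≤ -(z + s).re := by simp only [add_re, hs]; linarith
    have h2 : t / (2 * Real.pi) ≤ c' * T := by
      have : c₂ * T ≤ c' * T := by gcongr; exact le_max_right _ _
      refine le_trans (div_le_self ht.le ?_) (htc.trans this)
      linarith [Real.pi_gt_three]
    have hcT : 1 ≤ c' * T := by nlinarith
    calc (t / (2 * Real.pi)) ^ (-(z + s).re) ≤ (c' * T) ^ (-(z + s).re) :=
          Real.rpow_le_rpow (by positivity) h2 hy0
      _ ≤ (c' * T) ^ (1 / 2 - δ) := Real.rpow_le_rpow_of_exponent_le hcT hy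
      _ = c' ^ (1 / 2 - δ) * T ^ (1 / 2 - δ) := Real.mul_rpow (by linarith) (by linarith)
      _ ≤ c' * T ^ (1/2 - δ) := by
          gcongr
          calc c' ^ (1 / 2 - δ) ≤ c' ^ (1 : ℝ) :=
                Real.rpow_le_rpow_of_exponent_le hc1 (by linarith)
            _ = c' := Real.rpow_one _
  have b5 : ‖(K : ℂ) ^ s‖ = K ^ (-(1/2) + 3 * δ) := by
    rw [Complex.norm_cpow_eq_rpow_re_of_pos hK, hs]
  have b6 := hCg s hs
  have hp : 0 ≤ 1 / (‖s + 1‖ * ‖s + 2‖) := by positivity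
  have hT0 : 0 < T := by linarith
  rw [Jfun]
  simp only [norm_mul, norm_inv, b5]
  rw [norm_inv] at b3
  calc ‖s‖⁻¹ * ‖Gfun φ s‖ * K ^ (-(1/2) + 3 * δ) * ‖((2*Real.pi/t : ℝ) : ℂ)^(z+s)‖
        * ‖riemannZeta (1 - z - s)‖ * ‖riemannZeta (1 + w + s)‖ * ‖riemannZeta (2 + (w - z))‖⁻¹
      ≤ ‖s‖⁻¹ * (Cg / (‖s + 1‖ * ‖s + 2‖)) * K ^ (-(1/2) + 3 * δ) * (c' * T ^ (1/2 - δ))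
        * B * ((15 + 7 * Z) * ‖s‖) * D := by gcongr
    _ = _ := by
      field_simp

lemma Jfun_diff (φ : ℝ → ℝ) (K t : ℝ) (s z w : ℂ) (δ : ℝ) (hδ0 : 0 < δ) (hδ : δ < 1 / 18)
    (ht : 0 < t) (hs : s.re = -(1/2) + 3 * δ) (hz : ‖z‖ ≤ 2 * δ) (hw : ‖w‖ ≤ 2 * δ)
    (hwz : ‖w - z‖ ≤ 2 * δ) :
    DifferentiableAt ℂ (fun p : ℂ × ℂ => Jfun φ K s t p.1 p.2) (z, w) := by
  have hzr := re_bd hz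
  have hwr := re_bd hw
  have hwzr := re_bd hwz
  have hb : ((2*Real.pi/t : ℝ) : ℂ) ≠ 0 := by
    have : 0 < 2 * Real.pi / t := by positivity
    exact_mod_cast this.ne'
  have n1 : 1 - z - s ≠ 1 := by
    intro h; have := congrArg re h; simp [hs] at this; linarith
  have n2 : 1 + w + s ≠ 1 := by
    intro h; have := congrArg re h; simp [hs] at this; linarith
  have n3 : 1 < (2 + (w - z)).re := by
    simp only [add_re, re_ofNat]; linarith
  have n3' : 2 + (w - z) ≠ 1 := by
    intro h; rw [h] at n3; simp at n3
  unfold Jfun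
  refine DifferentiableAt.mul (DifferentiableAt.mul (DifferentiableAt.mul (DifferentiableAt.const_mul ?_ _)
    ?_) ?_) (DifferentiableAt.inv ?_ ?_)
  · exact DifferentiableAt.const_cpow (by fun_prop) (Or.inl hb)
  · exact DifferentiableAt.comp (g := riemannZeta) (f := fun p : ℂ × ℂ => 1 - p.1 - s) (z, w)
      (differentiableAt_riemannZeta n1) (by fun_prop)
  · exact DifferentiableAt.comp (g := riemannZeta) (f := fun p : ℂ × ℂ => 1 + p.2 + s) (z, w)
      (differentiableAt_riemannZeta n2) (by fun_prop)
  · exact DifferentiableAt.comp (g := riemannZeta) (f := fun p : ℂ × ℂ => 2 + (p.2 - p.1)) (z, w)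
      (differentiableAt_riemannZeta n3') (by fun_prop)
  · exact riemannZeta_ne_zero_of_one_lt_re n3

/-- bound for the contour integral on the line `Re s = -1/2 + 3δ`. -/
theorem statement17
    (μ : ℝ) (hμ0 : 0 < μ) (hμ1 : μ < 1/2) (φ : ℝ → ℝ) (hφ : SmoothingFn μ φ)
    (η : ℝ) (hη0 : 0 < η) (hη1 : η < 1/3)
    (δ : ℝ) (hδ0 : 0 < δ) (hδ1 : δ < η/(2*(2+3*η)))
    (c₁ c₂ ν : ℝ) (Cd : ℕ → ℝ) :
    ∃ Cb > (0:ℝ), ∃ T₁ : ℝ, ∀ T : ℝ, T₁ ≤ T → ∀ (T₀ : ℝ) (ω : ℝ → ℂ),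
      AdmissibleWeight c₁ c₂ ν Cd T T₀ ω →
      ∀ a b : ℂ, ‖a‖ ≤ δ → ‖b‖ ≤ δ →
        ‖∫ t : ℝ, ω t * lineInt (-(1/2) + 3*δ) (fun s =>
            riemannZeta (1-a) * riemannZeta (1-b) * I11 φ (T ^ (1+η)) a b s t
            + riemannZeta (1-a) * riemannZeta (1+b) * I12 φ (T ^ (1+η)) a b s t
            + riemannZeta (1+a) * riemannZeta (1-b) * I21 φ (T ^ (1+η)) a b s t
            + riemannZeta (1+a) * riemannZeta (1+b) * I22 φ (T ^ (1+η)) a b s t)‖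
          ≤ Cb * (T ^ (1+η)) ^ (-(1:ℝ)/2 + 3*δ) * T ^ ((3:ℝ)/2 - δ) := by
  have hδ : δ < 1 / 18 := by
    refine hδ1.trans ?_
    rw [div_lt_div_iff₀ (by positivity) (by norm_num)]
    linarith
  obtain ⟨C₁, hC₁0, hC₁⟩ := combo2 δ hδ0
  obtain ⟨C₂, hC₂0, hC₂⟩ := Jfun_bound μ hμ0 hμ1 φ hφ δ hδ0 hδ c₂
  refine ⟨|Cd 0| * (4 * (C₁ * C₂) * Real.pi) * |c₂ - c₁| + 1, by positivity, 1, ?_⟩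
  intro T hT T₀ ω hω a b ha hb
  have hT0 : 0 < T := by linarith
  set K : ℝ := T ^ (1 + η) with hKdef
  have hK : 0 < K := Real.rpow_pos_of_pos hT0 _
  set X : ℝ := K ^ (-(1/2) + 3 * δ) * T ^ (1/2 - δ) with hX
  have hX0 : 0 ≤ X := by positivity
  have inner : ∀ t : ℝ, 0 < t → t ≤ c₂ * T → ‖lineInt (-(1/2) + 3*δ) (fun s =>
            riemannZeta (1-a) * riemannZeta (1-b) * I11 φ K a b s t
            + riemannZeta (1-a) * riemannZeta (1+b) * I12 φ K a b s t
            + riemannZeta (1+a) * riemannZeta (1-b) * I21 φ K a b s t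
            + riemannZeta (1+a) * riemannZeta (1+b) * I22 φ K a b s t)‖
          ≤ 4 * (C₁ * C₂) * Real.pi * X := by
    intro t ht htc
    rw [lineInt]
    have hint : Integrable (fun u : ℝ => 4 * (C₁ * C₂) * X * (1 + u ^ 2)⁻¹) :=
      integrable_inv_one_add_sq.const_mul _
    refine (norm_integral_le_of_norm_le hint (Eventually.of_forall fun u => ?_)).trans
      (le_of_eq ?_)
    · set s : ℂ := ((-(1/2) + 3*δ : ℝ) : ℂ) + (u : ℂ) * Complex.I with hsdef
      have hs : s.re = -(1/2) + 3 * δ := by simp [hsdef]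
      have hsi : s.im = u := by simp [hsdef]
      have hs0 : s ≠ 0 := by
        intro h; have := congrArg re h; rw [hs] at this; simp at this; linarith
      rw [norm_mul, Complex.norm_I, mul_one, I11_eq φ K a b s t hs0, I12_eq, I21_eq,
        I22_eq φ K a b s t hs0]
      refine (hC₁ (Jfun φ K s t) (C₂ * X * (1 / (‖s + 1‖ * ‖s + 2‖))) ?_ ?_ a b ha hb).trans ?_
      · intro z w hz hw hwz
        exact hC₂ K T t s z w hK hT ht htc hs hz hw hwz
      · intro z w hz hw hwz
        exact Jfun_diff φ K t s z w δ hδ0 hδ ht hs hz hw hwz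
      · have q1 : (1 + u ^ 2) / 4 ≤ ‖s + 1‖ ^ 2 := by
          rw [← Complex.normSq_eq_norm_sq, Complex.normSq_apply]
          simp only [add_re, one_re, add_im, one_im, hs, hsi]
          nlinarith [sq_nonneg u]
        have q2 : ‖s + 1‖ ^ 2 ≤ ‖s + 2‖ ^ 2 := by
          rw [← Complex.normSq_eq_norm_sq, ← Complex.normSq_eq_norm_sq, Complex.normSq_apply,
            Complex.normSq_apply]
          simp only [add_re, one_re, add_im, one_im, hs, hsi, re_ofNat, im_ofNat]
          nlinarith
        have q3 : ‖s + 1‖ ≤ ‖s + 2‖ := (sq_le_sq₀ (norm_nonneg _) (norm_nonneg _)).mp q2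
        have q4 : (1 + u ^ 2) / 4 ≤ ‖s + 1‖ * ‖s + 2‖ := by
          nlinarith [norm_nonneg (s + 1)]
        have q5 : 1 / (‖s + 1‖ * ‖s + 2‖) ≤ 4 * (1 + u ^ 2)⁻¹ := by
          have := one_div_le_one_div_of_le (by positivity) q4
          refine this.trans (le_of_eq ?_)
          field_simp
        calc C₁ * (C₂ * X * (1 / (‖s + 1‖ * ‖s + 2‖)))
            ≤ C₁ * (C₂ * X * (4 * (1 + u ^ 2)⁻¹)) := by gcongr
          _ = _ := by ring
    · rw [integral_const_mul, integral_univ_inv_one_add_sq]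
      ring
  have outer : ∀ F : ℝ → ℂ, (∀ t : ℝ, 0 < t → t ≤ c₂ * T → ‖F t‖ ≤ 4 * (C₁ * C₂) * Real.pi * X) →
      ‖∫ t : ℝ, ω t * F t‖ ≤ |Cd 0| * (4 * (C₁ * C₂) * Real.pi * X) * (|c₂ - c₁| * T) := by
    intro F hF
    have e : ∫ t : ℝ, ω t * F t = ∫ t in Icc (c₁ * T) (c₂ * T), ω t * F t := by
      refine (setIntegral_eq_integral_of_forall_compl_eq_zero fun t ht => ?_).symm
      have : ω t = 0 := by
        by_contra h
        exact ht (hω.supp t h)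
      rw [this, zero_mul]
    have hc : 0 < c₂ - c₁ := sub_pos.mpr hω.hc₁₂
    rw [e]
    refine (norm_setIntegral_le_of_norm_le_const
      (C := |Cd 0| * (4 * (C₁ * C₂) * Real.pi * X)) (by simp) ?_).trans (le_of_eq ?_)
    · intro t ht
      have ht0 : 0 < t := lt_of_lt_of_le (mul_pos hω.hc₁ hT0) ht.1
      rw [norm_mul]
      have h1 : ‖ω t‖ ≤ |Cd 0| := by
        have := hω.deriv_bound 0 t
        simp only [iteratedDeriv_zero, pow_zero, mul_one] at this
        exact this.trans (le_abs_self _)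
      have h2 := hF t ht0 ht.2
      gcongr
    · rw [Real.volume_real_Icc_of_le (by nlinarith), abs_of_pos hc]
      ring
  refine (outer _ inner).trans ?_
  have hTT : T ^ ((3:ℝ)/2 - δ) = T ^ (1/2 - δ) * T := by
    rw [show (3:ℝ)/2 - δ = (1/2 - δ) + 1 by ring, Real.rpow_add_one hT0.ne']
  rw [hTT, show (-(1:ℝ)/2 + 3*δ) = -(1/2) + 3 * δ by ring]
  have hf : 0 ≤ X * T := by positivity
  calc |Cd 0| * (4 * (C₁ * C₂) * Real.pi * X) * (|c₂ - c₁| * T)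
      = (|Cd 0| * (4 * (C₁ * C₂) * Real.pi) * |c₂ - c₁|) * (X * T) := by ring
    _ ≤ (|Cd 0| * (4 * (C₁ * C₂) * Real.pi) * |c₂ - c₁| + 1) * (X * T) := by
        gcongr
        linarith
    _ = _ := by rw [hX]; ring

end CHN
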